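/- Let X be an n-correct set, μ a maximal curve for X of degree k ≤ n, B := X \ μ (which is an (n−k)-correct set), and A := X ∩ μ. Let A ∈ A, B ∈ B, C ∈ X. Then {A,B,C} is a special triplet of X if and only if both of the following hold: (i) the line ℓ₁ := ℓ_{AC} is a component of μ, i.e., μ = ℓ₁·μ_{k−1} with deg μ_{k−1} = k−1 (in particular B ∉ ℓ₁ and C ∈ A); (ii) the set {M ∈ ℓ₁ ∩ X : μ_{k−1}(M) ≠ 0} consists of A, C, and exactly n−k further nodes of X, and these n−k further nodes are precisely the zeros on ℓ₁ of the fundamental polynomial p*_{B,B} ∈ Π_{n−k} of B with respect to the (n−k)-correct set B (hence all zeros of p*_{B,B} on ℓ₁ are real and distinct). -/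

import Mathlib

open MvPolynomial Finset
open scoped Classical BigOperators

noncomputable section

/-- Points of the plane. -/
abbrev Pt : Type := Fin 2 → ℝ

/-- Bivariate real polynomials. -/
abbrev Poly2 : Type := MvPolynomial (Fin 2) ℝ

/-- `N = dim Π_n = (n+1)(n+2)/2`. -/
def Nn (n : ℕ) : ℕ := (n + 1) * (n + 2) / 2

/-- `X` is an `n`-correct set of nodes: it has `N` nodes and the only polynomial of total
degree at most `n` vanishing at all of them is the zero polynomial. -/
def IsNCorrect (n : ℕ) (X : Finset Pt) : Prop :=
  X.card = Nn n ∧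
  ∀ p : Poly2, p.totalDegree ≤ n → (∀ P ∈ X, eval P p = 0) → p = 0

/-- A line: a (nonzero) polynomial of total degree exactly 1. -/
def IsLine (ℓ : Poly2) : Prop := ℓ.totalDegree = 1

/-- The zero set of a polynomial, as a subset of the plane. -/
def zeroSet (q : Poly2) : Set Pt := {P : Pt | eval P q = 0}

/-- `X ∩ q` : the nodes of `X` lying on the curve `q`. -/
def zerosIn (X : Finset Pt) (q : Poly2) : Finset Pt := X.filter fun P => eval P q = 0

/-- `X \ q` : the nodes of `X` not lying on the curve `q`. -/
def nonzerosIn (X : Finset Pt) (q : Poly2) : Finset Pt := X.filter fun P => eval P q ≠ 0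

/-- `ℓ` is a maximal line for (an `n`-correct set) `X`: a line passing through
exactly `n+1` nodes. -/
def IsMaximalLine (n : ℕ) (X : Finset Pt) (ℓ : Poly2) : Prop :=
  IsLine ℓ ∧ (zerosIn X ℓ).card = n + 1

/-- The collection of maximal lines of `X` (as subsets of the plane). -/
def maximalLines (n : ℕ) (X : Finset Pt) : Set (Set Pt) :=
  {Z : Set Pt | ∃ ℓ : Poly2, IsMaximalLine n X ℓ ∧ Z = zeroSet ℓ}

/-- `p` is the `n`-fundamental polynomial of the node `A` of `X`. -/
def IsFund (n : ℕ) (X : Finset Pt) (A : Pt) (p : Poly2) : Prop :=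
  p.totalDegree ≤ n ∧ eval A p = 1 ∧ ∀ P ∈ X, P ≠ A → eval P p = 0

/-- The node `A` of `X` uses the curve `q`: `q` divides the fundamental polynomial of `A`. -/
def Uses (n : ℕ) (X : Finset Pt) (A : Pt) (q : Poly2) : Prop :=
  ∃ p : Poly2, IsFund n X A p ∧ q ∣ p

/-- `d(n,k) = k(2n+3-k)/2`. -/
def d (n k : ℕ) : ℕ := k * (2 * n + 3 - k) / 2

/-- `q` is a maximal curve of degree `k` for `X`: it passes through exactly `d(n,k)` nodes. -/
def IsMaximalCurve (n k : ℕ) (X : Finset Pt) (q : Poly2) : Prop :=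
  q.totalDegree = k ∧ (zerosIn X q).card = d n k

/-- `{A,B,C}` is a special triplet of the `n`-correct set `X` : there is a maximal curve `f`
of degree `n-1` with `X \ f = {A,B,C}`. -/
def IsSpecialTriplet (n : ℕ) (X : Finset Pt) (A B C : Pt) : Prop :=
  A ∈ X ∧ B ∈ X ∧ C ∈ X ∧ A ≠ B ∧ A ≠ C ∧ B ≠ C ∧
  ∃ f : Poly2, IsMaximalCurve n (n - 1) X f ∧ nonzerosIn X f = {A, B, C}

/-- `X` is a `GC_n` set: an `n`-correct set in which every fundamental polynomial is a
product of `n` linear factors. -/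
def IsGC (n : ℕ) (X : Finset Pt) : Prop :=
  IsNCorrect n X ∧
  ∀ A ∈ X, ∃ p : Poly2, IsFund n X A p ∧
    ∃ g : Fin n → Poly2, (∀ i, (g i).totalDegree = 1) ∧ p = ∏ i, g i

/-- `ℓ` is a line passing through the points `P` and `Q` (in particular, `ℓ_{PQ}` when
`P ≠ Q`). -/
def IsLineThrough (ℓ : Poly2) (P Q : Pt) : Prop :=
  IsLine ℓ ∧ eval P ℓ = 0 ∧ eval Q ℓ = 0

/-- `ℓ` is a `2`-node line of `X` passing through exactly the two nodes `A` and `B`. -/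
def IsTwoNodeLineOf (X : Finset Pt) (ℓ : Poly2) (A B : Pt) : Prop :=
  IsLine ℓ ∧ A ≠ B ∧ zerosIn X ℓ = {A, B}

/-- `Y` is an `n`-independent set: every point has an `n`-fundamental polynomial. -/
def IsNIndependent (n : ℕ) (Y : Finset Pt) : Prop :=
  ∀ A ∈ Y, ∃ p : Poly2, p.totalDegree ≤ n ∧ eval A p ≠ 0 ∧
    ∀ P ∈ Y, P ≠ A → eval P p = 0

/-- A family of lines is in general position: no two parallel (or equal) — i.e. any two of
them meet in a unique point — and no three concurrent. -/
def GenPos {m : ℕ} (ℓ : Fin m → Poly2) : Prop :=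
  (∀ i, IsLine (ℓ i)) ∧
  (∀ i j, i ≠ j → ∃! P : Pt, eval P (ℓ i) = 0 ∧ eval P (ℓ j) = 0) ∧
  (∀ i j k, i ≠ j → i ≠ k → j ≠ k →
    ¬∃ P : Pt, eval P (ℓ i) = 0 ∧ eval P (ℓ j) = 0 ∧ eval P (ℓ k) = 0)

/-- `X` is a Chung–Yao set of degree `n`: the set of pairwise intersection points of `n+2`
lines in general position. -/
def IsChungYao (n : ℕ) (X : Finset Pt) : Prop :=
  ∃ ℓ : Fin (n + 2) → Poly2, GenPos ℓ ∧
    (↑X : Set Pt) = {P : Pt | ∃ i j, i ≠ j ∧ eval P (ℓ i) = 0 ∧ eval P (ℓ j) = 0}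

/-- `X` is a Carnicer–Gasca set of degree `n`: the pairwise intersection points of `n+1`
lines in general position together with one extra point `A i` on each line `ℓ i`, the `A i`
lying on no other line of the family and not all collinear. -/
def IsCarnicerGasca (n : ℕ) (X : Finset Pt) : Prop :=
  ∃ (ℓ : Fin (n + 1) → Poly2) (A : Fin (n + 1) → Pt), GenPos ℓ ∧
    (∀ i j, eval (A i) (ℓ j) = 0 ↔ j = i) ∧
    (¬∃ L : Poly2, IsLine L ∧ ∀ i, eval (A i) L = 0) ∧
    (↑X : Set Pt) =
      {P : Pt | ∃ i j, i ≠ j ∧ eval P (ℓ i) = 0 ∧ eval P (ℓ j) = 0} ∪ Set.range A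

/-- The exponents of the bivariate monomials of total degree at most `m`. -/
def degreeSimplex (m : ℕ) : Finset (Σ _ : ℕ, ℕ × ℕ) :=
  (range (m + 1)).sigma fun i => antidiagonal i

lemma two_mul_Nn (m : ℕ) : 2 * Nn m = (m + 1) * (m + 2) :=
  Nat.two_mul_div_two_of_even (Nat.even_mul_succ_self (m + 1))

lemma card_degreeSimplex (m : ℕ) : (degreeSimplex m).card = Nn m := by
  have h : 2 * (degreeSimplex m).card = (m + 1) * (m + 2) := by
    simp only [degreeSimplex, card_sigma, Nat.card_antidiagonal]
    induction m with
    | zero => simp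
    | succ m ih => rw [sum_range_succ, mul_add, ih]; ring
  have := two_mul_Nn m
  omega

/-- The exponent vector of a bivariate monomial. -/
def exponent (s : Σ _ : ℕ, ℕ × ℕ) : Fin 2 →₀ ℕ :=
  Finsupp.single 0 s.2.1 + Finsupp.single 1 s.2.2

lemma exponent_zero (s : Σ _ : ℕ, ℕ × ℕ) : exponent s 0 = s.2.1 := by simp [exponent]

lemma exponent_one (s : Σ _ : ℕ, ℕ × ℕ) : exponent s 1 = s.2.2 := by simp [exponent]

lemma fst_eq_of_mem_degreeSimplex {m : ℕ} {s : Σ _ : ℕ, ℕ × ℕ} (hs : s ∈ degreeSimplex m) :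
    s.2.1 + s.2.2 = s.1 := by
  exact HasAntidiagonal.mem_antidiagonal.1 (mem_sigma.1 hs).2

lemma exponent_injective (m : ℕ) :
    Function.Injective fun s : degreeSimplex m => exponent s.1 := by
  rintro ⟨⟨i, a, b⟩, hs⟩ ⟨⟨j, a', b'⟩, ht⟩ h
  have h0 := DFunLike.congr_fun h 0
  have h1 := DFunLike.congr_fun h 1
  simp only [exponent_zero, exponent_one] at h0 h1
  have hi := fst_eq_of_mem_degreeSimplex hs
  have hj := fst_eq_of_mem_degreeSimplex ht
  simp only at hi hj
  subst h0 h1 hi hj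
  rfl

lemma totalDegree_monomial_exponent_le {m : ℕ} (s : degreeSimplex m) :
    (monomial (exponent s.1) (1 : ℝ)).totalDegree ≤ m := by
  obtain ⟨⟨i, a, b⟩, hs⟩ := s
  refine (totalDegree_monomial_le _ _).trans ?_
  have hi := fst_eq_of_mem_degreeSimplex hs
  simp only [degreeSimplex, mem_sigma, mem_range] at hs hi
  rw [Finsupp.sum_fintype _ _ (fun _ => rfl), Fin.sum_univ_two, exponent_zero, exponent_one]
  simp only [id_eq]
  omega

/-- Fewer than `dim Π_m` points impose a vanishing condition which some nonzero polynomial of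
degree at most `m` satisfies. -/
lemma exists_ne_zero_vanishing {m : ℕ} {Y : Finset Pt} (hY : Y.card < Nn m) :
    ∃ p : Poly2, p ≠ 0 ∧ p.totalDegree ≤ m ∧ ∀ P ∈ Y, eval P p = 0 := by
  let v : degreeSimplex m → Poly2 := fun s => monomial (exponent s.1) 1
  have hv : LinearIndependent ℝ v := by
    have := (basisMonomials (Fin 2) ℝ).linearIndependent.comp _ (exponent_injective m)
    simpa [Function.comp_def] using this
  let Φ : (degreeSimplex m → ℝ) →ₗ[ℝ] (Y → ℝ) :=
    (LinearMap.pi fun P : Y => (aeval (R := ℝ) P.1).toLinearMap) ∘ₗ Fintype.linearCombination ℝ v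
  have hker : LinearMap.ker Φ ≠ ⊥ := by
    apply LinearMap.ker_ne_bot_of_finrank_lt
    simpa [card_degreeSimplex] using hY
  obtain ⟨c, hc, hc0⟩ := (Submodule.ne_bot_iff _).1 hker
  refine ⟨∑ s, c s • v s, fun h => hc0 ?_, ?_, fun P hP => ?_⟩
  · exact funext (Fintype.linearIndependent_iff.1 hv c h)
  · refine totalDegree_finsetSum_le fun s _ => ?_
    exact (totalDegree_smul_le _ _).trans (totalDegree_monomial_exponent_le s)
  · have := congr_fun (LinearMap.mem_ker.1 hc) ⟨P, hP⟩
    simpa [Φ, Fintype.linearCombination_apply, aeval_eq_eval] using this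

/-- A curve of degree at most `m` misses at least `dim Π_{n-m}` nodes of an `n`-correct set. -/
lemma Nn_le_card_nonzerosIn {n m : ℕ} {X : Finset Pt} (hX : IsNCorrect n X) (hmn : m ≤ n)
    {q : Poly2} (hq : q.totalDegree ≤ m) (hq0 : q ≠ 0) :
    Nn (n - m) ≤ (nonzerosIn X q).card := by
  by_contra! h
  obtain ⟨p, hp0, hp, hpv⟩ := exists_ne_zero_vanishing h
  refine mul_ne_zero hq0 hp0 (hX.2 (q * p) ?_ fun P hP => ?_)
  · have := totalDegree_mul q p
    omega
  · by_cases hPq : eval P q = 0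
    · simp [hPq]
    · simp [hpv P (mem_filter.2 ⟨hP, hPq⟩)]

lemma card_zerosIn_add_card_nonzerosIn (X : Finset Pt) (q : Poly2) :
    (zerosIn X q).card + (nonzerosIn X q).card = X.card :=
  card_filter_add_card_filter_not _

lemma d_add_Nn {n k : ℕ} (hkn : k ≤ n) : d n k + Nn (n - k) = Nn n := by
  obtain ⟨m, rfl⟩ := Nat.exists_eq_add_of_le hkn
  have h1 := two_mul_Nn (k + m)
  have h2 := two_mul_Nn m
  have h3 : d (k + m) k = (k * (k + 2 * m + 3)) / 2 := by
    rw [d]; congr 2; omega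
  have h4 : Even (k * (k + 2 * m + 3)) := by
    rcases Nat.even_or_odd k with h | h
    · exact h.mul_right _
    · refine Even.mul_left ?_ _
      have : Odd (2 * m + 3) := ⟨m + 1, by ring⟩
      simpa [add_assoc] using h.add_odd this
  have h5 := Nat.two_mul_div_two_of_even h4
  rw [Nat.add_sub_cancel_left, h3]
  nlinarith

lemma card_nonzerosIn_iff {n k : ℕ} (hkn : k ≤ n) {X : Finset Pt} (hX : X.card = Nn n)
    {q : Poly2} : (zerosIn X q).card = d n k ↔ (nonzerosIn X q).card = Nn (n - k) := by
  have := card_zerosIn_add_card_nonzerosIn X q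
  have := d_add_Nn hkn
  omega

lemma IsNCorrect.nonzerosIn {n k : ℕ} {X : Finset Pt} (hX : IsNCorrect n X) (hkn : k ≤ n)
    {q : Poly2} (hq : IsMaximalCurve n k X q) (hq0 : q ≠ 0) :
    IsNCorrect (n - k) (nonzerosIn X q) := by
  refine ⟨(card_nonzerosIn_iff hkn hX.1).1 hq.2, fun p hp hpv => ?_⟩
  refine (mul_eq_zero.1 (hX.2 (q * p) ?_ fun P hP => ?_)).resolve_left hq0
  · have := totalDegree_mul q p
    have := hq.1
    omega
  · by_cases hPq : eval P q = 0
    · simp [hPq]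
    · simp [hpv P (mem_filter.2 ⟨hP, hPq⟩)]

lemma IsNCorrect.exists_isFund {m : ℕ} {Y : Finset Pt} (hY : IsNCorrect m Y) {B : Pt}
    (hB : B ∈ Y) : ∃ p, IsFund m Y B p := by
  have hlt : (Y.erase B).card < Nn m := hY.1 ▸ card_erase_lt_of_mem hB
  obtain ⟨p, hp0, hp, hpv⟩ := exists_ne_zero_vanishing hlt
  have hpB : eval B p ≠ 0 := fun h => hp0 <| hY.2 p hp fun P hP => by
    by_cases hPB : P = B
    · rwa [hPB]
    · exact hpv P (mem_erase.2 ⟨hPB, hP⟩)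
  refine ⟨(eval B p)⁻¹ • p, (totalDegree_smul_le _ _).trans hp, ?_, fun P hP hPB => ?_⟩
  · simp [smul_eval, hpB]
  · simp [smul_eval, hpv P (mem_erase.2 ⟨hPB, hP⟩)]

lemma IsNCorrect.isFund_unique {m : ℕ} {Y : Finset Pt} (hY : IsNCorrect m Y) {B : Pt}
    {p q : Poly2} (hp : IsFund m Y B p) (hq : IsFund m Y B q) : p = q := by
  refine sub_eq_zero.1 (hY.2 _ ((totalDegree_sub _ _).trans (max_le hp.1 hq.1)) fun P hP => ?_)
  by_cases hPB : P = B
  · simp [hPB, hp.2.1, hq.2.1]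
  · simp [hp.2.2 P hP hPB, hq.2.2 P hP hPB]

/-- An equation of the line through two distinct points. -/
def lineEq (P Q : Pt) : Poly2 :=
  (X 0 - C (P 0)) * C (Q 1 - P 1) - (X 1 - C (P 1)) * C (Q 0 - P 0)

lemma eval_lineEq (P Q M : Pt) :
    eval M (lineEq P Q) = (M 0 - P 0) * (Q 1 - P 1) - (M 1 - P 1) * (Q 0 - P 0) := by
  simp [lineEq]

lemma isLineThrough_lineEq {P Q : Pt} (hPQ : P ≠ Q) : IsLineThrough (lineEq P Q) P Q := by
  have hP : eval P (lineEq P Q) = 0 := by simp [eval_lineEq]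
  refine ⟨?_, hP, by rw [eval_lineEq]; ring⟩
  have hle : (lineEq P Q).totalDegree ≤ 1 := by
    have hlin (i : Fin 2) (a b : ℝ) : ((X i - C a) * C b : Poly2).totalDegree ≤ 1 := by
      refine (totalDegree_mul _ _).trans ?_
      have := totalDegree_sub_C_le (X i : Poly2) a
      simp_all
    exact (totalDegree_sub _ _).trans (max_le (hlin _ _ _) (hlin _ _ _))
  refine le_antisymm hle (Nat.one_le_iff_ne_zero.2 fun h0 => hPQ ?_)
  rw [totalDegree_eq_zero_iff_eq_C] at h0
  have hM : eval ![P 0 + (Q 1 - P 1), P 1 - (Q 0 - P 0)] (lineEq P Q) = 0 := by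
    rw [h0] at hP ⊢
    simpa using hP
  rw [eval_lineEq] at hM
  simp only [Matrix.cons_val_zero, Matrix.cons_val_one] at hM
  have hx : Q 0 - P 0 = 0 := by nlinarith [sq_nonneg (Q 0 - P 0), sq_nonneg (Q 1 - P 1)]
  have hy : Q 1 - P 1 = 0 := by nlinarith [sq_nonneg (Q 0 - P 0), sq_nonneg (Q 1 - P 1)]
  ext i
  fin_cases i
  · simp only [Fin.zero_eta]; linarith
  · simp only [Fin.mk_one]; linarith

lemma IsLine.ne_zero {ℓ : Poly2} (h : IsLine ℓ) : ℓ ≠ 0 := by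
  rintro rfl
  simp [IsLine] at h

lemma IsLine.prime {ℓ : Poly2} (h : IsLine ℓ) : Prime ℓ := by
  refine (irreducible_of_totalDegree_eq_one h fun x hx => ?_).prime
  obtain ⟨i, hi⟩ := ne_zero_iff.1 h.ne_zero
  exact isUnit_iff_ne_zero.2 fun hx0 => hi (by simpa [hx0] using hx i)

lemma eq_lineMap_of_eval_lineEq {P Q M : Pt} (hPQ : P ≠ Q) (hM : eval M (lineEq P Q) = 0) :
    ∃ t : ℝ, ∀ i, M i = P i + t * (Q i - P i) := by
  rw [eval_lineEq] at hM
  by_cases h0 : Q 0 - P 0 = 0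
  · have h1 : Q 1 - P 1 ≠ 0 := fun h1 => hPQ <| by
      ext i
      fin_cases i
      · simp only [Fin.zero_eta]; linarith
      · simp only [Fin.mk_one]; linarith
    have hM0 : M 0 - P 0 = 0 := by simpa [h0, h1] using hM
    refine ⟨(M 1 - P 1) / (Q 1 - P 1), fun i => ?_⟩
    fin_cases i
    · simp only [Fin.zero_eta, h0]; linarith
    · simp only [Fin.mk_one]; field_simp; ring
  · refine ⟨(M 0 - P 0) / (Q 0 - P 0), fun i => ?_⟩
    fin_cases i
    · simp only [Fin.zero_eta]; field_simp; ring
    · simp only [Fin.mk_one]; field_simp; linarith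

/-- A polynomial of degree at most `m` not vanishing at a point of a line has at most `m` zeros
on this line. -/
lemma card_zeros_on_line_le {m : ℕ} {P Q : Pt} (hPQ : P ≠ Q) {p : Poly2}
    (hp : p.totalDegree ≤ m) (hpP : eval P p ≠ 0) (S : Finset Pt)
    (hS : ∀ M ∈ S, eval M (lineEq P Q) = 0 ∧ eval M p = 0) : S.card ≤ m := by
  let f : Fin 2 → Polynomial ℝ := fun i =>
    Polynomial.C (Q i - P i) * Polynomial.X + Polynomial.C (P i)
  let r : Polynomial ℝ := aeval f p
  have hr (t : ℝ) : r.eval t = eval (fun i => P i + t * (Q i - P i)) p := by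
    have hid : (Polynomial.evalRingHom t).comp (algebraMap ℝ (Polynomial ℝ)) = RingHom.id ℝ := by
      ext; simp
    have hf : (fun i => Polynomial.evalRingHom t (f i)) = fun i => P i + t * (Q i - P i) := by
      funext i; simp [f]; ring
    rw [← Polynomial.coe_evalRingHom, map_aeval, hid, hf]
    rfl
  have hr0 : r ≠ 0 := fun h => hpP <| by
    have := hr 0
    simpa [h] using this.symm
  have hdeg : r.natDegree ≤ m := by
    simpa using aeval_natDegree_le p hp f (n := 1) fun i => Polynomial.natDegree_linear_le
  choose! t ht using fun M hM => eq_lineMap_of_eval_lineEq hPQ (hS M hM).1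
  calc S.card ≤ r.roots.toFinset.card := by
        refine card_le_card_of_injOn t (fun M hM => ?_) fun M hM M' hM' h => ?_
        · rw [mem_coe, Multiset.mem_toFinset, Polynomial.mem_roots hr0, Polynomial.IsRoot, hr,
            ← (hS M hM).2]
          congr 2
          exact (funext (ht M hM)).symm
        · ext i
          rw [ht M hM, ht M' hM', h]
    _ ≤ r.natDegree := (Multiset.toFinset_card_le _).trans r.card_roots'
    _ ≤ m := hdeg

/-- If a maximal curve `f` of degree `n - 1` misses only `A`, `B`, `C`, where `A` lies on the
maximal curve `μ` and `B` does not, then the line through `A` and `C` divides `μ`, and the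
cofactor times the fundamental polynomial of `B` is proportional to `f`. -/
lemma exists_eq_lineEq_mul {n k : ℕ} {X : Finset Pt} (hX : IsNCorrect n X) (hkn : k ≤ n)
    {μ : Poly2} (hμ : μ.totalDegree = k) {A B Q : Pt} (hAμ : eval A μ = 0)
    (hB : B ∈ X) (hBμ : eval B μ ≠ 0) (hAQ : A ≠ Q) (hn : 1 ≤ n)
    {f : Poly2} (hf : f.totalDegree = n - 1) (hfX : nonzerosIn X f = {A, B, Q})
    {p : Poly2} (hp : IsFund (n - k) (nonzerosIn X μ) B p) :
    ∃ μ' : Poly2, μ = lineEq A Q * μ' ∧ eval B (lineEq A Q) ≠ 0 ∧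
      ∃ a b : ℝ, a ≠ 0 ∧ b ≠ 0 ∧ a • f = b • (μ' * p) := by
  obtain ⟨hℓ, hAℓ, hQℓ⟩ := isLineThrough_lineEq hAQ
  set ℓ := lineEq A Q
  have hfA : eval A f ≠ 0 := by
    have : A ∈ nonzerosIn X f := by simp [hfX]
    exact (mem_filter.1 this).2
  have hfB : eval B f ≠ 0 := by
    have : B ∈ nonzerosIn X f := by simp [hfX]
    exact (mem_filter.1 this).2
  have hf0 : f ≠ 0 := fun h => hfA (by simp [h])
  have hfℓ : ∀ M ∈ X, M ≠ B → eval M (f * ℓ) = 0 := fun M hM hMB => by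
    by_cases hMf : eval M f = 0
    · simp [hMf]
    · have : M ∈ nonzerosIn X f := mem_filter.2 ⟨hM, hMf⟩
      rw [hfX, mem_insert, mem_insert, mem_singleton] at this
      rcases this with rfl | rfl | rfl
      · simp [hAℓ]
      · exact absurd rfl hMB
      · simp [hQℓ]
  have hfℓdeg : (f * ℓ).totalDegree ≤ n := by
    have := totalDegree_mul f ℓ
    have : ℓ.totalDegree = 1 := hℓ
    omega
  have hBℓ : eval B ℓ ≠ 0 := fun h => mul_ne_zero hf0 hℓ.ne_zero <|
    hX.2 _ hfℓdeg fun M hM => by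
      by_cases hMB : M = B
      · simp [hMB, h]
      · exact hfℓ M hM hMB
  have hμp : ∀ M ∈ X, M ≠ B → eval M (μ * p) = 0 := fun M hM hMB => by
    by_cases hMμ : eval M μ = 0
    · simp [hMμ]
    · simp [hp.2.2 M (mem_filter.2 ⟨hM, hMμ⟩) hMB]
  have hμpdeg : (μ * p).totalDegree ≤ n := by
    have := totalDegree_mul μ p
    have := hp.1
    omega
  have hb : eval B f * eval B ℓ ≠ 0 := mul_ne_zero hfB hBℓ
  have hprop : eval B μ • (f * ℓ) = (eval B f * eval B ℓ) • (μ * p) := by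
    refine sub_eq_zero.1 (hX.2 _ ((totalDegree_sub _ _).trans (max_le
      ((totalDegree_smul_le _ _).trans hfℓdeg) ((totalDegree_smul_le _ _).trans hμpdeg)))
      fun M hM => ?_)
    by_cases hMB : M = B
    · simp only [hMB, map_sub, smul_eval, map_mul, hp.2.1]; ring
    · simp only [map_sub, smul_eval, hfℓ M hM hMB, hμp M hM hMB]; ring
  have hdvd : ℓ ∣ μ * p := by
    refine ⟨((eval B f * eval B ℓ)⁻¹ * eval B μ) • f, ?_⟩
    rw [mul_smul_comm, mul_comm ℓ f, mul_smul, hprop, smul_smul, inv_mul_cancel₀ hb, one_smul]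
  rcases hℓ.prime.dvd_or_dvd hdvd with ⟨μ', rfl⟩ | ⟨r, rfl⟩
  · refine ⟨μ', rfl, hBℓ, _, _, hBμ, hb, mul_left_cancel₀ hℓ.ne_zero ?_⟩
    rw [mul_smul_comm, mul_smul_comm, mul_comm ℓ f, hprop, mul_assoc]
  · refine absurd ?_ (mul_ne_zero hBμ hfA)
    have : eval B μ • f = (eval B f * eval B ℓ) • (μ * r) := by
      refine mul_left_cancel₀ hℓ.ne_zero ?_
      rw [mul_smul_comm, mul_smul_comm, mul_comm ℓ f, hprop, mul_left_comm]
    simpa [smul_eval, hAμ] using congrArg (eval A) this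

/-- If `μ = ℓ μ'` is a maximal curve of degree `k` and `ℓ` is a line, then at least `n - k + 2`
nodes of `ℓ` lie off `μ'`. -/
lemma le_card_line_nodes {n k : ℕ} {X : Finset Pt} (hX : IsNCorrect n X) (hkn : k ≤ n)
    {ℓ μ' : Poly2} (hℓ : IsLine ℓ) (hμ' : μ' ≠ 0) (hμ : IsMaximalCurve n k X (ℓ * μ')) :
    n - k + 2 ≤ (X.filter fun M => eval M ℓ = 0 ∧ eval M μ' ≠ 0).card := by
  have hdeg : 1 + μ'.totalDegree = k := by
    rw [← hμ.1, totalDegree_mul_of_isDomain hℓ.ne_zero hμ', hℓ]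
  have hle := Nn_le_card_nonzerosIn hX (by omega) le_rfl hμ'
  have heq := (card_nonzerosIn_iff hkn hX.1).1 hμ.2
  have hsplit : nonzerosIn X μ' =
      nonzerosIn X (ℓ * μ') ∪ X.filter fun M => eval M ℓ = 0 ∧ eval M μ' ≠ 0 := by
    ext M
    simp only [nonzerosIn, mem_union, mem_filter, map_mul, ne_eq, mul_eq_zero]
    tauto
  have hcard := card_union_le (nonzerosIn X (ℓ * μ'))
    (X.filter fun M => eval M ℓ = 0 ∧ eval M μ' ≠ 0)
  rw [← hsplit, heq] at hcard
  have h1 := two_mul_Nn (n - k)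
  have h2 := two_mul_Nn (n - k + 1)
  have h3 : n - μ'.totalDegree = n - k + 1 := by omega
  rw [h3] at hle
  nlinarith

lemma IsMaximalCurve.ne_zero_of_mem {n k : ℕ} {X : Finset Pt} {μ : Poly2}
    (hμ : IsMaximalCurve n k X μ) {A : Pt} (hA : A ∈ X) (hAμ : eval A μ = 0) : k ≠ 0 := by
  rintro rfl
  have : (zerosIn X μ).card = 0 := by simp [hμ.2, d]
  exact card_ne_zero_of_mem (mem_filter.2 ⟨hA, hAμ⟩) this

/-- Theorem 1, characterization part: with `μ` a maximal curve of degree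
`k ≤ n` for the `n`-correct set `X`, `B := X \ μ` (an `(n-k)`-correct set), `𝒜 := X ∩ μ`,
`A ∈ 𝒜`, `B ∈ ℬ`, `C ∈ X` : the triplet `{A,B,C}` is special iff
(i) the line `ℓ₁ = ℓ_{AC}` is a component of `μ` (in particular `B ∉ ℓ₁` and `C ∈ 𝒜`), and
(ii) the set `ℓ̇₁ = {M ∈ ℓ₁ ∩ X : μ_{k-1}(M) ≠ 0}` consists of `A`, `C` and exactly `n-k`
further nodes of `X`, which coincide with the zeros on `ℓ₁` of the fundamental polynomial
`p*_{B,ℬ}` (hence those zeros are all real and distinct). -/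
theorem special_triplet_characterization (n k : ℕ) (X : Finset Pt)
    (hX : IsNCorrect n X) (hkn : k ≤ n)
    (μ : Poly2) (hμ : IsMaximalCurve n k X μ)
    (A B C : Pt) (hA : A ∈ X) (hAμ : eval A μ = 0)
    (hB : B ∈ X) (hBμ : eval B μ ≠ 0) (hC : C ∈ X) :
    IsSpecialTriplet n X A B C ↔
      (A ≠ C ∧
        ∃ ℓ₁ μ' : Poly2, IsLineThrough ℓ₁ A C ∧ μ = ℓ₁ * μ' ∧
          eval B ℓ₁ ≠ 0 ∧ eval C μ = 0 ∧
          A ∈ X.filter (fun M => eval M ℓ₁ = 0 ∧ eval M μ' ≠ 0) ∧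
          C ∈ X.filter (fun M => eval M ℓ₁ = 0 ∧ eval M μ' ≠ 0) ∧
          (X.filter fun M => eval M ℓ₁ = 0 ∧ eval M μ' ≠ 0).card = n - k + 2 ∧
          ∀ pB : Poly2, IsFund (n - k) (nonzerosIn X μ) B pB →
            (↑((X.filter fun M => eval M ℓ₁ = 0 ∧ eval M μ' ≠ 0) \ {A, C}) : Set Pt) =
              {M : Pt | eval M ℓ₁ = 0 ∧ eval M pB = 0}) := by
  have hk : k ≠ 0 := hμ.ne_zero_of_mem hA hAμ
  have hμ0 : μ ≠ 0 := fun h => hBμ (by simp [h])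
  have hcorr := hX.nonzerosIn hkn hμ hμ0
  have hBmem : B ∈ nonzerosIn X μ := mem_filter.2 ⟨hB, hBμ⟩
  obtain ⟨p, hp⟩ := hcorr.exists_isFund hBmem
  constructor
  · rintro ⟨-, -, -, hAB, hAC, hBC, f, hf, hfX⟩
    obtain ⟨μ', rfl, hBℓ, a, b, ha, hb, hab⟩ :=
      exists_eq_lineEq_mul hX hkn hμ.1 hAμ hB hBμ hAC (by omega) hf.1 hfX hp
    have hℓ := isLineThrough_lineEq hAC
    have hμ' : μ' ≠ 0 := right_ne_zero_of_mul hμ0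
    have hfp (M : Pt) : eval M f = 0 ↔ eval M μ' = 0 ∨ eval M p = 0 := by
      have := congrArg (eval M) hab
      simp only [smul_eval, map_mul] at this
      rw [← mul_eq_zero, ← mul_eq_zero_iff_left (b := eval M f) ha, this, mul_eq_zero_iff_left hb]
    have hmem (M : Pt) (hM : M ∈ ({A, B, C} : Finset Pt)) : eval M μ' ≠ 0 ∧ eval M p ≠ 0 := by
      rw [← hfX] at hM
      simpa [hfp] using (mem_filter.1 hM).2
    have hA' := hmem A (by simp)
    have hC' := hmem C (by simp)
    set L : Finset Pt := X.filter fun M => eval M (lineEq A C) = 0 ∧ eval M μ' ≠ 0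
    have hAL : A ∈ L := mem_filter.2 ⟨hA, hℓ.2.1, hA'.1⟩
    have hCL : C ∈ L := mem_filter.2 ⟨hC, hℓ.2.2, hC'.1⟩
    have hLp : ∀ M ∈ L \ {A, C}, eval M (lineEq A C) = 0 ∧ eval M p = 0 := fun M hM => by
      obtain ⟨hML, hMAC⟩ := mem_sdiff.1 hM
      obtain ⟨hMX, hMℓ, hMμ'⟩ := mem_filter.1 hML
      refine ⟨hMℓ, ?_⟩
      by_contra hMp
      have hMf : M ∈ nonzerosIn X f := mem_filter.2 ⟨hMX, by simp [hfp, hMμ', hMp]⟩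
      rw [hfX] at hMf
      simp only [mem_insert, mem_singleton, not_or] at hMf hMAC
      rcases hMf with h | rfl | h
      · exact hMAC.1 h
      · exact hBℓ hMℓ
      · exact hMAC.2 h
    have hcardAC : (L \ {A, C}).card + 2 = L.card := by
      have hsub : ({A, C} : Finset Pt) ⊆ L := by simp [insert_subset_iff, hAL, hCL]
      have := card_sdiff_add_card_eq_card hsub
      rwa [card_pair hAC] at this
    have hlower : n - k + 2 ≤ L.card := le_card_line_nodes hX hkn hℓ.1 hμ' hμ
    have hupper : (L \ {A, C}).card ≤ n - k := card_zeros_on_line_le hAC hp.1 hA'.2 _ hLp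
    have hcardL : L.card = n - k + 2 := le_antisymm (by lia) hlower
    refine ⟨hAC, lineEq A C, μ', hℓ, rfl, hBℓ, by simp [hℓ.2.2], hAL, hCL, hcardL,
      fun q hq => ?_⟩
    rw [hcorr.isFund_unique hq hp]
    ext M
    refine ⟨hLp M, fun hM => ?_⟩
    by_contra h
    have hML : M ∉ L \ {A, C} := h
    have hins := card_zeros_on_line_le hAC hp.1 hA'.2 (insert M (L \ {A, C})) fun M' hM' => by
      rcases mem_insert.1 hM' with rfl | h
      · exact hM
      · exact hLp M' h
    rw [card_insert_of_notMem hML] at hins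
    lia
  · rintro ⟨hAC, ℓ, μ', hℓ, rfl, hBℓ, hCμ, hAL, hCL, -, hset⟩
    have hset := hset p hp
    set L : Finset Pt := X.filter fun M => eval M ℓ = 0 ∧ eval M μ' ≠ 0
    have hmem (M : Pt) : M ∈ L \ {A, C} ↔ eval M ℓ = 0 ∧ eval M p = 0 := by
      rw [← mem_coe, hset]; rfl
    have hA' := (mem_filter.1 hAL).2
    have hC' := (mem_filter.1 hCL).2
    have hAp : eval A p ≠ 0 := fun h => by simpa using (hmem A).2 ⟨hA'.1, h⟩
    have hCp : eval C p ≠ 0 := fun h => by simpa using (hmem C).2 ⟨hC'.1, h⟩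
    have hAB : A ≠ B := by rintro rfl; exact hBμ hAμ
    have hBC : B ≠ C := by rintro rfl; exact hBμ hCμ
    have hμ' : μ' ≠ 0 := right_ne_zero_of_mul hμ0
    have hp0 : p ≠ 0 := fun h => hAp (by simp [h])
    have hX3 : nonzerosIn X (μ' * p) = {A, B, C} := by
      ext M
      simp only [nonzerosIn, mem_filter, mem_insert, mem_singleton, map_mul, ne_eq, mul_eq_zero,
        not_or]
      constructor
      · rintro ⟨hMX, hMμ', hMp⟩
        by_contra! hM
        by_cases hMℓ : eval M ℓ = 0
        · refine hMp ((hmem M).1 (mem_sdiff.2 ⟨mem_filter.2 ⟨hMX, hMℓ, hMμ'⟩, ?_⟩)).2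
          simp [hM.1, hM.2.2]
        · exact hMp (hp.2.2 M (mem_filter.2 ⟨hMX, by simp [hMℓ, hMμ']⟩) hM.2.1)
      · rintro (rfl | rfl | rfl)
        · exact ⟨hA, hA'.2, hAp⟩
        · exact ⟨hB, fun h => hBμ (by simp [h]), by simp [hp.2.1]⟩
        · exact ⟨hC, hC'.2, hCp⟩
    have hcard : (nonzerosIn X (μ' * p)).card = 3 := by
      rw [hX3, card_eq_three]
      exact ⟨A, B, C, hAB, hAC, hBC, rfl⟩
    have hdeg : 1 + μ'.totalDegree = k := by
      rw [← hμ.1, totalDegree_mul_of_isDomain hℓ.1.ne_zero hμ', hℓ.1]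
    have hle : (μ' * p).totalDegree ≤ n - 1 := by
      have := totalDegree_mul μ' p
      have := hp.1
      omega
    refine ⟨hA, hB, hC, hAB, hAC, hBC, μ' * p, ⟨?_, ?_⟩, hX3⟩
    · by_contra hne
      have := Nn_le_card_nonzerosIn hX (m := n - 2) (by omega) (q := μ' * p) (by omega)
        (mul_ne_zero hμ' hp0)
      rw [hcard, show n - (n - 2) = 2 by omega] at this
      simp [Nn] at this
    · rw [card_nonzerosIn_iff (by omega) hX.1, hcard, show n - (n - 1) = 1 by omega]
      simp [Nn]
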